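/- arXiv:2203.08645 — 2 statements merged into one kernel-verified Lean document; each statement's English description precedes it below -/
import Mathlib

section
/- Let f : 2^{[k]} → ℝ be submodular, increasing, and normalized. Then the set V = {−1,0,1}^k is representative for the Lovász hinge: for every probability distribution p on Y = {−1,1}^k there exists v ∈ V such that L^f(v; p) ≤ L^f(u; p) for all u ∈ ℝ^k. -/
open Finset

noncomputable section

/-- The set {π(1),…,π(i)} of the first `i` elements under permutation `π`. -/
def Spi (k : ℕ) (π : Equiv.Perm (Fin k)) (i : ℕ) : Finset (Fin k) :=
  (Finset.univ.filter (fun m : Fin k => (m : ℕ) < i)).image π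

/-- The Lovász extension of a set function `f`. -/
def lovaszExt (k : ℕ) (f : Finset (Fin k) → ℝ) (x : Fin k → ℝ) : ℝ :=
  Finset.univ.sup' Finset.univ_nonempty
    (fun π : Equiv.Perm (Fin k) =>
      ∑ i : Fin k, x (π i) * (f (Spi k π ((i : ℕ) + 1)) - f (Spi k π (i : ℕ))))

/-- The Lovász hinge `L^f(u,y) = F((𝟙 - u ⊙ y)₊)`. -/
def lovaszHinge (k : ℕ) (f : Finset (Fin k) → ℝ) (u y : Fin k → ℝ) : ℝ :=
  lovaszExt k f (fun i => max (1 - u i * y i) 0)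

/-- The `±1` vector associated with a Boolean vector, indexing the outcome space `Y = {-1,1}^k`. -/
def ytov (k : ℕ) (b : Fin k → Bool) : Fin k → ℝ := fun i => if b i then 1 else -1

/-- `p` is a probability distribution on `Y = {-1,1}^k`. -/
def IsProb (k : ℕ) (p : (Fin k → ℝ) → ℝ) : Prop :=
  (∀ b : Fin k → Bool, 0 ≤ p (ytov k b)) ∧ ∑ b : Fin k → Bool, p (ytov k b) = 1

/-- Expected Lovász hinge loss `L^f(u; p)`. -/
def expLossL (k : ℕ) (f : Finset (Fin k) → ℝ) (u : Fin k → ℝ) (p : (Fin k → ℝ) → ℝ) : ℝ :=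
  ∑ b : Fin k → Bool, p (ytov k b) * lovaszHinge k f u (ytov k b)

variable {k : ℕ}

lemma Spi_zero (π : Equiv.Perm (Fin k)) : Spi k π 0 = ∅ := by
  simp [Spi]

lemma Spi_self (π : Equiv.Perm (Fin k)) : Spi k π k = Finset.univ := by
  simp [Spi]

lemma mem_Spi (π : Equiv.Perm (Fin k)) (m : ℕ) (e : Fin k) :
    e ∈ Spi k π m ↔ ((π.symm e : Fin k) : ℕ) < m := by
  simp only [Spi, mem_image, mem_filter, mem_univ, true_and]
  constructor
  · rintro ⟨a, ha, rfl⟩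
    simpa using ha
  · intro h
    exact ⟨π.symm e, h, by simp⟩

lemma Spi_succ (π : Equiv.Perm (Fin k)) (i : Fin k) :
    Spi k π (i + 1) = insert (π i) (Spi k π i) := by
  ext e
  rw [mem_insert, mem_Spi, mem_Spi, ← Equiv.symm_apply_eq, Fin.ext_iff]
  omega

lemma apply_notMem_Spi (π : Equiv.Perm (Fin k)) (i : Fin k) : π i ∉ Spi k π i := by
  simp [mem_Spi]

/-- The marginal value of the element `e` when elements are added in the order `π`. -/
def gain (f : Finset (Fin k) → ℝ) (π : Equiv.Perm (Fin k)) (e : Fin k) : ℝ :=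
  f (Spi k π ((π.symm e : ℕ) + 1)) - f (Spi k π (π.symm e : ℕ))

lemma gain_apply (f : Finset (Fin k) → ℝ) (π : Equiv.Perm (Fin k)) (i : Fin k) :
    gain f π (π i) = f (Spi k π (i + 1)) - f (Spi k π i) := by
  simp [gain]

lemma sum_gain (f : Finset (Fin k) → ℝ) (π : Equiv.Perm (Fin k)) (x : Fin k → ℝ) :
    ∑ i : Fin k, x (π i) * (f (Spi k π ((i : ℕ) + 1)) - f (Spi k π (i : ℕ))) =
      ∑ e, x e * gain f π e := by
  rw [← Equiv.sum_comp π (fun e => x e * gain f π e)]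
  simp [gain_apply]

lemma sum_gain_le_lovaszExt (f : Finset (Fin k) → ℝ) (π : Equiv.Perm (Fin k))
    (x : Fin k → ℝ) : ∑ e, x e * gain f π e ≤ lovaszExt k f x := by
  rw [← sum_gain]
  exact Finset.le_sup' (fun π : Equiv.Perm (Fin k) =>
      ∑ i : Fin k, x (π i) * (f (Spi k π ((i : ℕ) + 1)) - f (Spi k π (i : ℕ))))
    (Finset.mem_univ π)

lemma lovaszExt_le_iff (f : Finset (Fin k) → ℝ) (x : Fin k → ℝ) (a : ℝ) :
    lovaszExt k f x ≤ a ↔ ∀ π, ∑ e, x e * gain f π e ≤ a := by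
  simp [lovaszExt, sum_gain]

lemma gain_nonneg {f : Finset (Fin k) → ℝ}
    (hinc : ∀ S T : Finset (Fin k), Disjoint S T → f S ≤ f (S ∪ T))
    (π : Equiv.Perm (Fin k)) (e : Fin k) : 0 ≤ gain f π e := by
  obtain ⟨i, rfl⟩ := π.surjective e
  rw [gain_apply, Spi_succ, sub_nonneg, ← Finset.union_singleton]
  exact hinc _ _ (by simpa using apply_notMem_Spi π i)

lemma lovaszExt_mono {f : Finset (Fin k) → ℝ}
    (hinc : ∀ S T : Finset (Fin k), Disjoint S T → f S ≤ f (S ∪ T))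
    {x x' : Fin k → ℝ} (h : x ≤ x') : lovaszExt k f x ≤ lovaszExt k f x' := by
  rw [lovaszExt_le_iff]
  intro π
  refine le_trans (Finset.sum_le_sum fun e _ => ?_) (sum_gain_le_lovaszExt f π x')
  exact mul_le_mul_of_nonneg_right (h e) (gain_nonneg hinc π e)

lemma sum_Spi_gain {f : Finset (Fin k) → ℝ} (hnorm : f ∅ = 0) (π : Equiv.Perm (Fin k))
    {m : ℕ} (hm : m ≤ k) : ∑ e ∈ Spi k π m, gain f π e = f (Spi k π m) := by
  induction m with
  | zero => simp [Spi_zero, hnorm]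
  | succ m ih =>
    have h := Spi_succ π ⟨m, hm⟩
    have h' := gain_apply f π ⟨m, hm⟩
    have hn := apply_notMem_Spi π ⟨m, hm⟩
    simp only at h h' hn
    rw [h, Finset.sum_insert hn, ih (by omega), h', h]
    ring

/-- The marginal vector of a submodular function lies in its base polytope. -/
lemma sum_gain_le {f : Finset (Fin k) → ℝ}
    (hsub : ∀ S T : Finset (Fin k), f (S ∪ T) + f (S ∩ T) ≤ f S + f T)
    (hnorm : f ∅ = 0) (π : Equiv.Perm (Fin k)) (T : Finset (Fin k)) :
    ∑ e ∈ T, gain f π e ≤ f T := by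
  have key : ∀ m ≤ k, ∑ e ∈ Spi k π m ∩ T, gain f π e ≤ f (Spi k π m ∩ T) := by
    intro m hm
    induction m with
    | zero => simp [Spi_zero, hnorm]
    | succ m ih =>
      have h := Spi_succ π ⟨m, hm⟩
      have h' := gain_apply f π ⟨m, hm⟩
      have hn := apply_notMem_Spi π ⟨m, hm⟩
      simp only at h h' hn
      have ih := ih (by omega)
      by_cases hT : π ⟨m, hm⟩ ∈ T
      · rw [h, Finset.insert_inter_of_mem hT, Finset.sum_insert (by simp [hn]), h', h]
        have hs := hsub (insert (π ⟨m, hm⟩) (Spi k π m ∩ T)) (Spi k π m)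
        rw [Finset.insert_inter_of_notMem hn, Finset.insert_union,
          Finset.union_eq_right.2 Finset.inter_subset_left,
          Finset.inter_eq_left.2 Finset.inter_subset_left] at hs
        linarith
      · rw [h, Finset.insert_inter_of_notMem hT]
        exact ih
  simpa [Spi_self] using key k le_rfl

/-- Abel summation along the order `π`. -/
lemma sum_mul_nonneg_of_antitone {π : Equiv.Perm (Fin k)} {x d : Fin k → ℝ}
    (hx : Antitone (x ∘ π)) (hx0 : ∀ e, 0 ≤ x e)
    (hd : ∀ m ≤ k, 0 ≤ ∑ e ∈ Spi k π m, d e) : 0 ≤ ∑ e, x e * d e := by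
  have key : ∀ m (hm : m < k),
      x (π ⟨m, hm⟩) * ∑ e ∈ Spi k π (m + 1), d e ≤ ∑ e ∈ Spi k π (m + 1), x e * d e := by
    intro m
    induction m with
    | zero =>
      intro hm
      have h := Spi_succ π ⟨0, hm⟩
      simp only [Spi_zero] at h
      simp [h]
    | succ m ih =>
      intro hm
      have h := Spi_succ π ⟨m + 1, hm⟩
      have hn := apply_notMem_Spi π ⟨m + 1, hm⟩
      simp only at h hn
      rw [h, Finset.sum_insert hn, Finset.sum_insert hn, mul_add]
      have h1 := mul_le_mul_of_nonneg_right
        (hx (show (⟨m, by omega⟩ : Fin k) ≤ ⟨m + 1, hm⟩ by simp)) (hd (m + 1) hm.le)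
      simp only [Function.comp_apply] at h1
      linarith [ih (by omega)]
  cases k with
  | zero => simp
  | succ n =>
    have h := key n (by omega)
    rw [Spi_self] at h
    refine le_trans (mul_nonneg (hx0 _) ?_) h
    simpa [Spi_self] using hd (n + 1) le_rfl

/-- The greedy order attains the maximum in the Lovász extension. -/
lemma lovaszExt_eq_of_antitone {f : Finset (Fin k) → ℝ}
    (hsub : ∀ S T : Finset (Fin k), f (S ∪ T) + f (S ∩ T) ≤ f S + f T)
    (hnorm : f ∅ = 0) {π : Equiv.Perm (Fin k)} {x : Fin k → ℝ}
    (hx : Antitone (x ∘ π)) (hx0 : ∀ e, 0 ≤ x e) :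
    lovaszExt k f x = ∑ e, x e * gain f π e := by
  refine le_antisymm ((lovaszExt_le_iff f x _).2 fun σ => ?_) (sum_gain_le_lovaszExt f π x)
  have h := sum_mul_nonneg_of_antitone (d := fun e => gain f π e - gain f σ e) hx hx0
    (fun m hm => by
      rw [Finset.sum_sub_distrib, sum_Spi_gain hnorm π hm, sub_nonneg]
      exact sum_gain_le hsub hnorm σ _)
  simp only [mul_sub, Finset.sum_sub_distrib] at h
  linarith

/-- For `t > 0`, the odd step function which rounds `x` to its sign if `|x| ≥ t` and to `0` otherwise. -/
def signStep (t x : ℝ) : ℝ :=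
  Set.indicator (Set.Iic x) 1 t - Set.indicator (Set.Iic (-x)) 1 t

lemma signStep_neg (t x : ℝ) : signStep t (-x) = -signStep t x := by
  simp [signStep]

lemma signStep_mem (t x : ℝ) :
    signStep t x = -1 ∨ signStep t x = 0 ∨ signStep t x = 1 := by
  simp only [signStep, Set.indicator_apply, Set.mem_Iic, Pi.one_apply]
  split_ifs <;> norm_num

lemma signStep_mono (t : ℝ) : Monotone (signStep t) := by
  intro x y h
  simp only [signStep, Set.indicator_apply, Set.mem_Iic, Pi.one_apply]
  split_ifs <;> first | (exfalso; linarith) | norm_num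

lemma integrableOn_indicator_Iic (x : ℝ) :
    MeasureTheory.IntegrableOn (Set.indicator (Set.Iic x) (1 : ℝ → ℝ)) (Set.Ioc 0 1) := by
  refine MeasureTheory.Integrable.indicator ?_ measurableSet_Iic
  exact MeasureTheory.integrable_const (1 : ℝ)

lemma integrableOn_signStep (x : ℝ) :
    MeasureTheory.IntegrableOn (fun t => signStep t x) (Set.Ioc 0 1) :=
  (integrableOn_indicator_Iic x).sub (integrableOn_indicator_Iic (-x))

lemma integral_signStep {x : ℝ} (h1 : -1 ≤ x) (h2 : x ≤ 1) :
    ∫ t in Set.Ioc (0 : ℝ) 1, signStep t x = x := by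
  have h : ∀ z : ℝ, z ≤ 1 →
      ∫ t in Set.Ioc (0 : ℝ) 1, Set.indicator (Set.Iic z) (1 : ℝ → ℝ) t = max z 0 := by
    intro z hz
    rw [MeasureTheory.integral_indicator_one measurableSet_Iic,
      MeasureTheory.measureReal_restrict_apply measurableSet_Iic, Set.inter_comm,
      Set.Ioc_inter_Iic, min_eq_right hz, MeasureTheory.measureReal_def, Real.volume_Ioc,
      ENNReal.toReal_ofReal', sub_zero]
  simp only [signStep]
  rw [MeasureTheory.integral_sub (integrableOn_indicator_Iic x)
    (integrableOn_indicator_Iic (-x)), h x h2, h (-x) (by linarith)]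
  rcases le_total x 0 with hx | hx
  · rw [max_eq_right hx, max_eq_left (by linarith)]; ring
  · rw [max_eq_left hx, max_eq_right (by linarith)]; ring

/-- An affine lower bound that holds for all roundings of `u` holds for `u` itself. -/
lemma le_affine_of_forall_signStep {u : Fin k → ℝ} (hu : ∀ i, -1 ≤ u i ∧ u i ≤ 1)
    {m a : ℝ} {c : Fin k → ℝ}
    (h : ∀ t : ℝ, m ≤ a + ∑ i, c i * signStep t (u i)) :
    m ≤ a + ∑ i, c i * u i := by
  have hint : MeasureTheory.IntegrableOn (fun t => ∑ i, c i * signStep t (u i))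
      (Set.Ioc (0 : ℝ) 1) :=
    MeasureTheory.integrable_finsetSum _ fun i _ => (integrableOn_signStep (u i)).const_mul (c i)
  have hle := MeasureTheory.setIntegral_mono_on
    (MeasureTheory.integrable_const (μ := MeasureTheory.volume.restrict (Set.Ioc (0 : ℝ) 1)) m)
    ((MeasureTheory.integrable_const a).add hint) measurableSet_Ioc
    (fun t _ => h t)
  have heq : ∫ t in Set.Ioc (0 : ℝ) 1, ∑ i, c i * signStep t (u i) = ∑ i, c i * u i := by
    rw [MeasureTheory.integral_finsetSum _
      fun i _ => (integrableOn_signStep (u i)).const_mul (c i)]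
    refine Finset.sum_congr rfl fun i _ => ?_
    rw [MeasureTheory.integral_const_mul, integral_signStep (hu i).1 (hu i).2]
  simp only [Pi.add_apply] at hle
  rw [MeasureTheory.integral_add (MeasureTheory.integrable_const a) hint, heq] at hle
  simpa using hle

lemma exists_antitone_comp_perm (x : Fin k → ℝ) :
    ∃ π : Equiv.Perm (Fin k), Antitone (x ∘ π) := by
  refine ⟨Tuple.sort (fun i => -x i), fun i j hij => ?_⟩
  simpa using Tuple.monotone_sort (fun i => -x i) hij

lemma ytov_eq (b : Fin k → Bool) (i : Fin k) : ytov k b i = 1 ∨ ytov k b i = -1 := by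
  unfold ytov
  split_ifs <;> simp

lemma lovaszHinge_clip_le {f : Finset (Fin k) → ℝ}
    (hinc : ∀ S T : Finset (Fin k), Disjoint S T → f S ≤ f (S ∪ T))
    (u : Fin k → ℝ) (b : Fin k → Bool) :
    lovaszHinge k f (fun i => max (-1) (min (u i) 1)) (ytov k b) ≤
      lovaszHinge k f u (ytov k b) := by
  refine lovaszExt_mono hinc fun i => ?_
  rcases ytov_eq b i with h | h <;> simp only [h] <;>
    rcases max_cases (-1) (min (u i) 1) with h1 | h1 <;>
    rcases min_cases (u i) 1 with h2 | h2 <;>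
    refine max_le ?_ (le_max_right _ _) <;>
    rw [le_max_iff] <;>
    first | (left; linarith) | (right; linarith)

/-- The hinges of all roundings of `u` agree with one affine function minorizing the hinge. -/
lemma exists_affine_lovaszHinge {f : Finset (Fin k) → ℝ}
    (hsub : ∀ S T : Finset (Fin k), f (S ∪ T) + f (S ∩ T) ≤ f S + f T)
    (hnorm : f ∅ = 0) {u : Fin k → ℝ} (hu : ∀ i, -1 ≤ u i ∧ u i ≤ 1) (b : Fin k → Bool) :
    ∃ (a : ℝ) (c : Fin k → ℝ),
      (∀ t : ℝ, lovaszHinge k f (fun i => signStep t (u i)) (ytov k b) =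
        a + ∑ i, c i * signStep t (u i)) ∧
      a + ∑ i, c i * u i ≤ lovaszHinge k f u (ytov k b) := by
  obtain ⟨π, hπ⟩ := exists_antitone_comp_perm (fun i => 1 - u i * ytov k b i)
  have hsum : ∀ v : Fin k → ℝ, ∑ e, gain f π e + ∑ e, (-ytov k b e * gain f π e) * v e =
      ∑ e, (1 - v e * ytov k b e) * gain f π e := by
    intro v
    rw [← Finset.sum_add_distrib]
    exact Finset.sum_congr rfl fun e _ => by ring
  have hmax : ∀ v : Fin k → ℝ, (∀ i, -1 ≤ v i ∧ v i ≤ 1) →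
      (fun i => max (1 - v i * ytov k b i) 0) = fun i => 1 - v i * ytov k b i := by
    intro v hv
    funext i
    refine max_eq_left ?_
    have := hv i
    rcases ytov_eq b i with h | h <;> rw [h] <;> linarith
  refine ⟨∑ e, gain f π e, fun e => -ytov k b e * gain f π e, fun t => ?_, ?_⟩
  · have hv : ∀ i, -1 ≤ signStep t (u i) ∧ signStep t (u i) ≤ 1 := fun i => by
      rcases signStep_mem t (u i) with h | h | h <;> rw [h] <;> norm_num
    have hmul : ∀ i, signStep t (u i) * ytov k b i = signStep t (u i * ytov k b i) := by
      intro i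
      rcases ytov_eq b i with h | h <;> simp [h, signStep_neg]
    rw [hsum]
    have hm := hmax _ hv
    have h0 : ∀ e, 0 ≤ 1 - signStep t (u e) * ytov k b e := fun e => by
      rw [← congrFun hm e]
      exact le_max_right _ _
    unfold lovaszHinge
    rw [hm]
    refine lovaszExt_eq_of_antitone hsub hnorm ?_ h0
    intro i j hij
    have := hπ hij
    simp only [Function.comp_apply, hmul] at this ⊢
    have := signStep_mono t (show u (π i) * ytov k b (π i) ≤ u (π j) * ytov k b (π j) by linarith)
    linarith
  · rw [hsum]
    unfold lovaszHinge
    rw [hmax u hu]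
    exact sum_gain_le_lovaszExt f π _

/-- `V = {-1,0,1}^k` is representative for the Lovász hinge. -/
theorem stmt4 (k : ℕ) (hk : 1 ≤ k) (f : Finset (Fin k) → ℝ)
    (hsub : ∀ S T : Finset (Fin k), f (S ∪ T) + f (S ∩ T) ≤ f S + f T)
    (hinc : ∀ S T : Finset (Fin k), Disjoint S T → f S ≤ f (S ∪ T))
    (hnorm : f ∅ = 0)
    (p : (Fin k → ℝ) → ℝ) (hp : IsProb k p) :
    ∃ v : Fin k → ℝ, (∀ i, v i = -1 ∨ v i = 0 ∨ v i = 1) ∧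
      ∀ u : Fin k → ℝ, expLossL k f v p ≤ expLossL k f u p := by
  have hfin : {v : Fin k → ℝ | ∀ i, v i = -1 ∨ v i = 0 ∨ v i = 1}.Finite := by
    refine (Set.Finite.pi' (fun _ : Fin k => Set.toFinite ({-1, 0, 1} : Set ℝ))).subset ?_
    intro v hv i
    simpa using hv i
  obtain ⟨v, hv, hmin⟩ := Set.exists_min_image _ (fun v => expLossL k f v p) hfin
    ⟨fun _ => 0, fun _ => by simp⟩
  refine ⟨v, hv, fun u => ?_⟩
  set w : Fin k → ℝ := fun i => max (-1) (min (u i) 1) with hw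
  have hw1 : ∀ i, -1 ≤ w i ∧ w i ≤ 1 := fun i =>
    ⟨le_max_left _ _, max_le (by norm_num) (min_le_right _ _)⟩
  have hclip : expLossL k f w p ≤ expLossL k f u p :=
    Finset.sum_le_sum fun b _ =>
      mul_le_mul_of_nonneg_left (lovaszHinge_clip_le hinc u b) (hp.1 b)
  refine le_trans ?_ hclip
  choose a c hround hle using exists_affine_lovaszHinge hsub hnorm hw1
  have hsum : ∀ z : Fin k → ℝ, ∑ b, p (ytov k b) * (a b + ∑ i, c b i * z i) =
      ∑ b, p (ytov k b) * a b + ∑ i, (∑ b, p (ytov k b) * c b i) * z i := by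
    intro z
    simp only [mul_add, Finset.sum_add_distrib, Finset.mul_sum, Finset.sum_mul, ← mul_assoc]
    rw [Finset.sum_comm]
  calc expLossL k f v p
      ≤ ∑ b, p (ytov k b) * a b + ∑ i, (∑ b, p (ytov k b) * c b i) * w i := by
        refine le_affine_of_forall_signStep hw1 fun t => ?_
        refine (hmin (fun i => signStep t (w i)) fun i => signStep_mem t (w i)).trans_eq ?_
        rw [← hsum]
        exact Finset.sum_congr rfl fun b _ => by rw [hround b t]
    _ = ∑ b, p (ytov k b) * (a b + ∑ i, c b i * w i) := (hsum w).symm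
    _ ≤ expLossL k f w p :=
        Finset.sum_le_sum fun b _ => mul_le_mul_of_nonneg_left (hle b) (hp.1 b)
end
end

section
/- Fix ε > 0. The link envelope Ψ̂ is nonempty pointwise, i.e., Ψ̂(u) ≠ ∅ for all u ∈ ℝ^k, if and only if ε ≤ 1/(2k). -/
open Finset

noncomputable section

/-- Componentwise clipping of `u` to `[-1,1]^k`. -/
def clip {k : ℕ} (u : Fin k → ℝ) : Fin k → ℝ := fun i => Real.sign (u i) * min |u i| 1

/-- The indicator vector `𝟙_{π,i}` of `{π(1),…,π(i)}`. -/
def onespi (k : ℕ) (π : Equiv.Perm (Fin k)) (i : ℕ) : Fin k → ℝ :=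
  fun j => if j ∈ Spi k π i then 1 else 0

/-- `V^face`: all subsets of some `V_{π,y}`. -/
def Vface (k : ℕ) : Set (Set (Fin k → ℝ)) :=
  {V' | ∃ (π : Equiv.Perm (Fin k)) (y : Fin k → ℝ), (∀ i, y i = -1 ∨ y i = 1) ∧
      V' ⊆ {v | ∃ i ≤ k, v = fun j => onespi k π i j * y j}}

/-- The link envelope `Ψ̂(u)`: the intersection of all `V' ∈ V^face` whose convex hull is
within sup-distance `ε` of the clipped point `⌊u⌉`. -/
def psiHat (k : ℕ) (ε : ℝ) (u : Fin k → ℝ) : Set (Fin k → ℝ) :=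
  ⋂₀ {V' | V' ∈ Vface k ∧ ∃ a ∈ convexHull ℝ V', ‖a - clip u‖ < ε}

theorem mem_Spi_iff {k : ℕ} (π : Equiv.Perm (Fin k)) (i : ℕ) (j : Fin k) :
    j ∈ Spi k π i ↔ (π.symm j : ℕ) < i := by
  simp only [Spi, Finset.mem_image, Finset.mem_filter, Finset.mem_univ, true_and]
  constructor
  · rintro ⟨m, hm, rfl⟩
    simpa using hm
  · intro h
    exact ⟨π.symm j, h, by simp⟩

theorem mem_Spi_one_iff {k : ℕ} (i : ℕ) (j : Fin k) : j ∈ Spi k 1 i ↔ (j : ℕ) < i :=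
  mem_Spi_iff 1 i j

theorem clip_eq_self {k : ℕ} {u : Fin k → ℝ} (hpos : ∀ j, 0 < u j) (hle : ∀ j, u j ≤ 1) :
    clip u = u := by
  ext j
  simp [clip, Real.sign_of_pos (hpos j), abs_of_pos (hpos j), hle j]

theorem LinearMap.le_of_mem_convexHull {E : Type*} [AddCommGroup E] [Module ℝ E]
    (φ : E →ₗ[ℝ] ℝ) {s : Set E} {c : ℝ} (h : ∀ w ∈ s, φ w ≤ c) {a : E}
    (ha : a ∈ convexHull ℝ s) : φ a ≤ c :=
  convexHull_min (t := {w | φ w ≤ c}) h (convex_halfSpace_le φ.isLinear c) ha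

/-- If a point of the hull of a face has its coordinates in `S` above the level `t`, relative to the
signs `y`, and the others below, then the vertex supported on `S` is in the face. -/
theorem vertex_mem_of_separated {k : ℕ} (hk : 1 ≤ k) {π : Equiv.Perm (Fin k)}
    {y : Fin k → ℝ} (hy : ∀ i, y i = -1 ∨ y i = 1) {V : Set (Fin k → ℝ)}
    (hV : V ⊆ {v | ∃ i ≤ k, v = fun j => onespi k π i j * y j})
    {a : Fin k → ℝ} (ha : a ∈ convexHull ℝ V) {S : Finset (Fin k)} {t : ℝ}
    (ht0 : 0 ≤ t) (ht1 : t ≤ 1) (hS : ∀ j ∈ S, t < y j * a j) (hSc : ∀ j ∉ S, y j * a j < t) :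
    (fun j => if j ∈ S then y j else 0) ∈ V := by
  have hyy : ∀ j, y j * y j = 1 := fun j => by rcases hy j with h | h <;> simp [h]
  by_contra hv
  have key : ∀ w ∈ V, ∃ i, Spi k π i ≠ S ∧
      ∀ j, y j * w j = if j ∈ Spi k π i then 1 else 0 := by
    intro w hw
    obtain ⟨i, -, rfl⟩ := hV hw
    refine ⟨i, ?_, fun j => ?_⟩
    · rintro rfl
      apply hv
      convert hw using 2 with j
      simp [onespi]
    · simp only [onespi]
      split_ifs <;> simp [hyy]
  let φ : Fin k → (Fin k → ℝ) →ₗ[ℝ] ℝ := fun j => y j • LinearMap.proj j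
  have hφ : ∀ j w, φ j w = y j * w j := fun j w => by simp [φ]
  rcases S.eq_empty_or_nonempty with hSe | hSn
  · obtain ⟨q, -, hq⟩ := Finset.exists_min_image Finset.univ (fun j => (π.symm j : ℕ))
      ⟨⟨0, hk⟩, Finset.mem_univ _⟩
    have h := (-φ q).le_of_mem_convexHull (c := -1) (fun w hw => ?_) ha
    · have := hSc q (by simp [hSe])
      simp only [LinearMap.neg_apply, hφ] at h
      linarith
    · obtain ⟨i, hi, hw'⟩ := key w hw
      have hqi : q ∈ Spi k π i := by
        obtain ⟨j, hj⟩ := Finset.nonempty_iff_ne_empty.2 (hSe ▸ hi)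
        rw [mem_Spi_iff] at hj ⊢
        exact (hq j (Finset.mem_univ _)).trans_lt hj
      simp [hφ, hw', hqi]
  · obtain ⟨p, hpS, hp⟩ := Finset.exists_max_image S (fun j => (π.symm j : ℕ)) hSn
    have hsub : ∀ i, p ∈ Spi k π i → S ⊆ Spi k π i := by
      intro i hpi j hj
      rw [mem_Spi_iff] at hpi ⊢
      exact (hp j hj).trans_lt hpi
    rcases Sᶜ.eq_empty_or_nonempty with hSe | hScn
    · have h := (φ p).le_of_mem_convexHull (c := 0) (fun w hw => ?_) ha
      · have := hS p hpS
        rw [hφ] at h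
        linarith
      · obtain ⟨i, hi, hw'⟩ := key w hw
        have hpi : p ∉ Spi k π i := by
          intro hpi
          rw [Finset.compl_eq_empty_iff] at hSe
          have := hsub i hpi
          rw [hSe, Finset.univ_subset_iff] at this
          exact hi (this.trans hSe.symm)
        simp [hφ, hw', hpi]
    · obtain ⟨q, hqS, hq⟩ := Finset.exists_min_image Sᶜ (fun j => (π.symm j : ℕ)) hScn
      have h := (φ p - φ q).le_of_mem_convexHull (c := 0) (fun w hw => ?_) ha
      · have h1 := hS p hpS
        have h2 := hSc q (Finset.mem_compl.1 hqS)
        simp only [LinearMap.sub_apply, hφ] at h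
        linarith
      · obtain ⟨i, hi, hw'⟩ := key w hw
        have hpq : p ∈ Spi k π i → q ∈ Spi k π i := by
          intro hpi
          by_contra hqi
          refine hi (Finset.Subset.antisymm (fun j hj => ?_) (hsub i hpi))
          by_contra hjS
          refine hqi ?_
          rw [mem_Spi_iff] at hj ⊢
          exact (hq j (Finset.mem_compl.2 hjS)).trans_lt hj
        simp only [LinearMap.sub_apply, hφ, hw']
        split_ifs <;> simp_all

/-- Among the `k + 1` levels `i / k`, one is at distance at least `1 / (2 k)` from `k` given
reals. -/
theorem exists_level_separated {k : ℕ} (hk : 1 ≤ k) {ε : ℝ} (hε : ε ≤ 1 / (2 * k))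
    (z : Fin k → ℝ) : ∃ t : ℝ, 0 ≤ t ∧ t ≤ 1 ∧ ∀ j, ε ≤ |z j - t| := by
  have hk0 : (0 : ℝ) < k := by exact_mod_cast hk
  by_contra! h
  have hlev : ∀ i : Fin (k + 1), ∃ j, |z j - (i : ℕ) / k| < ε := fun i =>
    h _ (by positivity) ((div_le_one hk0).2 (by exact_mod_cast Nat.lt_succ_iff.1 i.2))
  choose f hf using hlev
  have hinj : Function.Injective f := by
    intro i i' hii
    have h1 := abs_lt.1 (hf i)
    have h2 := abs_lt.1 (hf i')
    rw [hii] at h1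
    have hεk : 2 * ε * k ≤ 1 := by
      rw [le_div_iff₀ (by positivity)] at hε
      linarith
    have e1 : ((i : ℕ) : ℝ) / k * k = (i : ℕ) := div_mul_cancel₀ _ hk0.ne'
    have e2 : ((i' : ℕ) : ℝ) / k * k = (i' : ℕ) := div_mul_cancel₀ _ hk0.ne'
    have l1 : ((i : ℕ) : ℝ) < (i' : ℕ) + 1 := by nlinarith
    have l2 : ((i' : ℕ) : ℝ) < (i : ℕ) + 1 := by nlinarith
    norm_cast at l1 l2
    ext
    omega
  simpa using Fintype.card_le_of_injective f hinj

theorem psiHat_nonempty {k : ℕ} (hk : 1 ≤ k) {ε : ℝ} (hε : 0 < ε) (hle : ε ≤ 1 / (2 * k))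
    (u : Fin k → ℝ) : (psiHat k ε u).Nonempty := by
  obtain ⟨t, ht0, ht1, ht⟩ := exists_level_separated hk hle (fun j => |clip u j|)
  refine ⟨fun j => if j ∈ Finset.univ.filter (fun j => t < |clip u j|)
    then Real.sign (clip u j) else 0, ?_⟩
  rintro V ⟨⟨π, y, hy, hV⟩, a, ha, hax⟩
  have hclose : ∀ j, |a j - clip u j| < ε := fun j => (norm_le_pi_norm (a - clip u) j).trans_lt hax
  have hnn : ∀ j, 0 ≤ y j * a j := by
    intro j
    have h := (-(y j • LinearMap.proj j) : (Fin k → ℝ) →ₗ[ℝ] ℝ).le_of_mem_convexHull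
      (c := 0) (fun w hw => ?_) ha
    · simpa using h
    · obtain ⟨i, -, rfl⟩ := hV hw
      simp only [onespi]
      rcases hy j with h | h <;> simp [h] <;> split_ifs <;> norm_num
  have hsep : ∀ j, t < |clip u j| → y j = Real.sign (clip u j) ∧ t < y j * a j := by
    intro j hj
    have h1 := ht j
    rw [abs_of_pos (sub_pos.2 hj)] at h1
    have h2 := abs_lt.1 (hclose j)
    have h3 := hnn j
    rcases lt_or_ge (clip u j) 0 with hneg | hpos
    · rw [abs_of_neg hneg] at h1
      rw [Real.sign_of_neg hneg]
      rcases hy j with h | h <;> rw [h] at h3 ⊢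
      · exact ⟨rfl, by linarith⟩
      · linarith
    · rw [abs_of_nonneg hpos] at h1
      rw [Real.sign_of_pos (by linarith)]
      rcases hy j with h | h <;> rw [h] at h3 ⊢
      · linarith
      · exact ⟨rfl, by linarith⟩
  have hmem := vertex_mem_of_separated hk hy hV ha
    (S := Finset.univ.filter (fun j => t < |clip u j|)) ht0 ht1
    (fun j hj => (hsep j (by simpa using hj)).2) (fun j hj => by
      have hj' : |clip u j| ≤ t := by simpa using hj
      have h1 := ht j
      rw [abs_of_nonpos (sub_nonpos.2 hj')] at h1
      have h2 := abs_lt.1 (hclose j)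
      have h3 := neg_abs_le (clip u j)
      have h4 := le_abs_self (clip u j)
      rcases hy j with h | h <;> rw [h] <;> linarith)
  convert hmem using 2 with j
  split_ifs with hj
  · exact (hsep j (by simpa using hj)).1.symm
  · rfl

/-- The average of all vertices of the standard simplex but the `i`-th is close to the midpoint
`j ↦ (k - j - 1/2) / k`. -/
theorem exists_mem_convexHull_erase {k : ℕ} (hk : 1 ≤ k) {i : ℕ} (hi : i ≤ k) :
    ∃ a ∈ convexHull ℝ {v | ∃ l ≤ k, l ≠ i ∧ v = onespi k 1 l},
      ‖a - fun j : Fin k => ((k : ℝ) - (j : ℕ) - 1 / 2) / k‖ ≤ 1 / (2 * k) := by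
  have hk0 : (0 : ℝ) < k := by exact_mod_cast hk
  have hirange : i ∈ Finset.range (k + 1) := Finset.mem_range.2 (by omega)
  refine ⟨∑ l ∈ (Finset.range (k + 1)).erase i, (1 / k : ℝ) • onespi k 1 l,
    (convex_convexHull ℝ _).sum_mem (fun _ _ => by positivity) ?_ fun l hl => ?_, ?_⟩
  · rw [Finset.sum_const, Finset.card_erase_of_mem hirange]
    simp [hk0.ne']
  · rw [Finset.mem_erase, Finset.mem_range] at hl
    exact subset_convexHull ℝ _ ⟨l, by omega, hl.1, rfl⟩
  · rw [pi_norm_le_iff_of_nonneg (by positivity)]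
    intro j
    have hsum : ∑ l ∈ Finset.range (k + 1), onespi k 1 l j = (k : ℝ) - (j : ℕ) := by
      have hfil : (Finset.range (k + 1)).filter (fun l => (j : ℕ) < l) =
          Finset.Ioc (j : ℕ) k := by
        ext l
        simp only [Finset.mem_filter, Finset.mem_range, Finset.mem_Ioc]
        omega
      simp only [onespi, mem_Spi_one_iff]
      rw [Finset.sum_boole, hfil, Nat.card_Ioc, Nat.cast_sub j.2.le]
    have hval : (∑ l ∈ (Finset.range (k + 1)).erase i, (1 / k : ℝ) • onespi k 1 l) j
        = ((k : ℝ) - (j : ℕ) - onespi k 1 i j) / k := by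
      rw [← hsum, ← Finset.sum_erase_eq_sub hirange, Finset.sum_apply, Finset.sum_div]
      exact Finset.sum_congr rfl fun l _ => by simp [div_eq_inv_mul]
    have hdiff : ((k : ℝ) - (j : ℕ) - onespi k 1 i j) / k - ((k : ℝ) - (j : ℕ) - 1 / 2) / k
        = (1 - 2 * onespi k 1 i j) / (2 * k) := by
      field_simp
      ring
    rw [Pi.sub_apply, hval, hdiff, Real.norm_eq_abs, abs_div,
      abs_of_pos (by positivity : (0 : ℝ) < 2 * k)]
    gcongr
    simp only [onespi]
    split_ifs <;> norm_num

theorem eq_of_onespi_one_eq {k i l : ℕ} (hi : i ≤ k) (hl : l ≤ k)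
    (h : onespi k 1 i = onespi k 1 l) : i = l := by
  have hiff : ∀ j : Fin k, (j : ℕ) < i ↔ (j : ℕ) < l := by
    intro j
    have := congrFun h j
    simp only [onespi, mem_Spi_one_iff] at this
    split_ifs at this <;> first | tauto | norm_num at this
  by_contra hne
  rcases lt_or_gt_of_ne hne with hlt | hlt
  · exact lt_irrefl i ((hiff ⟨i, by omega⟩).2 hlt)
  · exact lt_irrefl l ((hiff ⟨l, by omega⟩).1 hlt)

theorem psiHat_eq_empty {k : ℕ} (hk : 1 ≤ k) {ε : ℝ} (hε : 1 / (2 * k) < ε) :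
    psiHat k ε (fun j : Fin k => ((k : ℝ) - (j : ℕ) - 1 / 2) / k) = ∅ := by
  have hk0 : (0 : ℝ) < k := by exact_mod_cast hk
  have hclip : clip (fun j : Fin k => ((k : ℝ) - (j : ℕ) - 1 / 2) / k) =
      fun j : Fin k => ((k : ℝ) - (j : ℕ) - 1 / 2) / k := by
    refine clip_eq_self (fun j => ?_) (fun j => ?_)
    · have : ((j : ℕ) : ℝ) + 1 ≤ k := by exact_mod_cast j.2
      exact div_pos (by linarith) hk0
    · have : (0 : ℝ) ≤ (j : ℕ) := by positivity
      rw [div_le_one hk0]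
      linarith
  have hmem : ∀ v ∈ psiHat k ε (fun j : Fin k => ((k : ℝ) - (j : ℕ) - 1 / 2) / k),
      ∀ i ≤ k, ∃ l ≤ k, l ≠ i ∧ v = onespi k 1 l := by
    intro v hv i hi
    obtain ⟨a, ha, hax⟩ := exists_mem_convexHull_erase hk hi
    refine hv _ ⟨⟨1, 1, fun _ => Or.inr rfl, ?_⟩, a, ha, ?_⟩
    · rintro w ⟨l, hl, -, rfl⟩
      exact ⟨l, hl, by simp⟩
    · rw [hclip]
      exact hax.trans_lt hε
  rw [Set.eq_empty_iff_forall_notMem]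
  intro v hv
  obtain ⟨l, hl, -, hvl⟩ := hmem v hv 0 (Nat.zero_le _)
  obtain ⟨m, hm, hml, hvm⟩ := hmem v hv l hl
  exact hml (eq_of_onespi_one_eq hm hl (hvm.symm.trans hvl))

/-- the link envelope `Ψ̂` is nonempty pointwise iff `ε ≤ 1/(2k)`. -/
theorem stmt17 (k : ℕ) (hk : 1 ≤ k) (ε : ℝ) (hε : 0 < ε) :
    (∀ u : Fin k → ℝ, (psiHat k ε u).Nonempty) ↔ ε ≤ 1 / (2 * k) := by
  refine ⟨fun h => ?_, fun h => psiHat_nonempty hk hε h⟩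
  by_contra! hlt
  exact (h _).ne_empty (psiHat_eq_empty hk hlt)
end
end
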